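/- ∑_{n≥0} (-1)^n q^{3n²} / ((-q;q²)_n (q⁴;q⁴)_n) = (q², q³, q⁵; q⁵)_∞ / (q²;q²)_∞. -/

import Mathlib

open scoped BigOperators

/-- Finite q-Pochhammer symbol $(a;q)_n$. -/
noncomputable def qPoch (q a : ℂ) (n : ℕ) : ℂ := ∏ j ∈ Finset.range n, (1 - a * q ^ j)

/-- Infinite q-Pochhammer symbol $(a;q)_\infty$. -/
noncomputable def qPochInf (q a : ℂ) : ℂ := ∏' j : ℕ, (1 - a * q ^ j)

/-- The reciprocal `1 / (p;p)_k`. -/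
noncomputable def qFactInv (p : ℂ) (k : ℕ) : ℂ := (qPoch p p k)⁻¹

/-- The reciprocal `1 / (p;p)_{n-r}`, with the convention that it vanishes for `n < r`. -/
noncomputable def qFactInvSub (p : ℂ) (n r : ℕ) : ℂ := if r ≤ n then qFactInv p (n - r) else 0

/-- Two sequences `α`, `β` form a Bailey pair relative to `1`, in base `p`. -/
def IsBaileyPair (p : ℂ) (α β : ℕ → ℂ) : Prop :=
  ∀ n, ∑ r ∈ Finset.range (n + 1), α r * (qFactInvSub p n r * qFactInv p (n + r)) = β n

theorem qPoch_zero (q a : ℂ) : qPoch q a 0 = 1 := by simp [qPoch]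

theorem qPoch_succ (q a : ℂ) (n : ℕ) : qPoch q a (n + 1) = qPoch q a n * (1 - a * q ^ n) := by
  simp [qPoch, Finset.prod_range_succ]

theorem qFactInv_zero (p : ℂ) : qFactInv p 0 = 1 := by simp [qFactInv, qPoch_zero]

theorem one_sub_ne_zero_of_norm_lt_one {z : ℂ} (hz : ‖z‖ < 1) : 1 - z ≠ 0 := by
  intro h
  rw [← sub_eq_zero.mp h] at hz
  simp at hz

theorem norm_mul_pow_lt_one {p a : ℂ} (hp : ‖p‖ < 1) (ha : ‖a‖ < 1) (n : ℕ) :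
    ‖a * p ^ n‖ < 1 := by
  rw [norm_mul, norm_pow]
  exact mul_lt_one_of_nonneg_of_lt_one_left (norm_nonneg a) ha
    (pow_le_one₀ (norm_nonneg p) hp.le)

theorem norm_pow_lt_one {p : ℂ} (hp : ‖p‖ < 1) {n : ℕ} (hn : n ≠ 0) : ‖p ^ n‖ < 1 := by
  rw [norm_pow]
  exact pow_lt_one₀ (norm_nonneg p) hp hn

theorem one_sub_mul_pow_ne_zero {p a : ℂ} (hp : ‖p‖ < 1) (ha : ‖a‖ < 1) (n : ℕ) :
    1 - a * p ^ n ≠ 0 :=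
  one_sub_ne_zero_of_norm_lt_one (norm_mul_pow_lt_one hp ha n)

theorem one_sub_pow_ne_zero {p : ℂ} (hp : ‖p‖ < 1) {n : ℕ} (hn : n ≠ 0) : 1 - p ^ n ≠ 0 :=
  one_sub_ne_zero_of_norm_lt_one (norm_pow_lt_one hp hn)

theorem qPoch_ne_zero {p a : ℂ} (hp : ‖p‖ < 1) (ha : ‖a‖ < 1) (n : ℕ) : qPoch p a n ≠ 0 :=
  Finset.prod_ne_zero_iff.mpr fun j _ => one_sub_mul_pow_ne_zero hp ha j

theorem qFactInv_eq_succ {p : ℂ} (hp : ‖p‖ < 1) (k : ℕ) :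
    qFactInv p k = (1 - p ^ (k + 1)) * qFactInv p (k + 1) := by
  have h := one_sub_mul_pow_ne_zero hp hp k
  have h' := qPoch_ne_zero hp hp k
  rw [qFactInv, qFactInv, qPoch_succ, pow_succ']
  field_simp

theorem qFactInvSub_of_lt (p : ℂ) {n r : ℕ} (h : n < r) : qFactInvSub p n r = 0 :=
  if_neg (not_le.mpr h)

theorem qFactInvSub_zero_right (p : ℂ) (n : ℕ) : qFactInvSub p n 0 = qFactInv p n := by
  simp [qFactInvSub]

theorem qFactInvSub_succ_succ (p : ℂ) (n r : ℕ) :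
    qFactInvSub p (n + 1) (r + 1) = qFactInvSub p n r := by
  simp [qFactInvSub]

theorem qFactInvSub_add_add (p : ℂ) (n r k : ℕ) :
    qFactInvSub p (k + n) (k + r) = qFactInvSub p n r := by
  simp [qFactInvSub, Nat.add_sub_add_left]

theorem pow_mul_qFactInvSub {p : ℂ} (hp : ‖p‖ < 1) (n r : ℕ) :
    p ^ r * qFactInvSub p n r = (p ^ r - p ^ (n + 1)) * qFactInvSub p (n + 1) r := by
  rcases lt_trichotomy r (n + 1) with h | rfl | h
  · obtain ⟨d, rfl⟩ := Nat.exists_eq_add_of_le (Nat.lt_succ_iff.mp h)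
    have h1 : r + d + 1 - r = d + 1 := by omega
    rw [qFactInvSub, qFactInvSub, if_pos (by omega), if_pos (by omega), h1,
      Nat.add_sub_cancel_left, qFactInv_eq_succ hp d]
    ring
  · simp [qFactInvSub_of_lt]
  · rw [qFactInvSub_of_lt p h, qFactInvSub_of_lt p (by omega)]
    simp

/-- The `q`-Chu–Vandermonde sum, in the limiting form used in Bailey's lemma. -/
theorem sum_pow_mul_qFactInv {p : ℂ} (hp0 : p ≠ 0) (hp : ‖p‖ < 1) (s M : ℕ) :
    ∑ m ∈ Finset.range (M + 1),
        p ^ (m * m + m * s) * (qFactInvSub p M m * qFactInv p m * qFactInv p (m + s)) =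
      qFactInv p M * qFactInv p (M + s) := by
  induction M with
  | zero => simp [qFactInvSub_zero_right, qFactInv_zero]
  | succ M ih =>
    have key : ∀ k, ∑ m ∈ Finset.range (k + 1),
        ((1 - p ^ (M + 1)) * (1 - p ^ (M + 1 + s)) * (p ^ (m * m + m * s) *
            (qFactInvSub p (M + 1) m * qFactInv p m * qFactInv p (m + s))) -
          p ^ (m * m + m * s) * (qFactInvSub p M m * qFactInv p m * qFactInv p (m + s))) =
        -p ^ (M + 1) * p ^ (k * k + k + (k + 1) * s) *
          (qFactInvSub p M k * qFactInv p k * qFactInv p (k + s)) := by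
      intro k
      induction k with
      | zero =>
        simp only [zero_add, Finset.sum_range_one, qFactInvSub_zero_right, qFactInv_eq_succ hp M]
        ring
      | succ k ihk =>
        rw [Finset.sum_range_succ, ihk, ← qFactInvSub_succ_succ p M k, qFactInv_eq_succ hp k,
          qFactInv_eq_succ hp (k + s), show k + s + 1 = k + 1 + s by ring]
        have h := pow_mul_qFactInvSub hp M (k + 1)
        refine mul_left_cancel₀ (pow_ne_zero (k + 1) hp0) ?_
        generalize qFactInvSub p (M + 1) (k + 1) = u at *
        generalize qFactInvSub p M (k + 1) = v at *
        generalize qFactInv p (k + 1) = x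
        generalize qFactInv p (k + 1 + s) = y
        have e1 : p ^ ((k + 1) * (k + 1) + (k + 1) + (k + 1 + 1) * s) =
          p ^ (k * k + k + (k + 1) * s) * (p ^ (k + 1) * p ^ (k + 1) * p ^ s) := by ring
        have e2 : p ^ ((k + 1) * (k + 1) + (k + 1) * s) =
          p ^ (k * k + k + (k + 1) * s) * p ^ (k + 1) := by ring
        rw [e1, e2, pow_add p (M + 1) s, pow_add p (k + 1) s]
        generalize p ^ (k * k + k + (k + 1) * s) = a
        generalize p ^ (M + 1) = P at *
        generalize p ^ (k + 1) = z at *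
        generalize p ^ s = S
        linear_combination (a * z * x * y * (P * z * S - 1)) * h
    have h := key (M + 1)
    rw [qFactInvSub_of_lt p M.lt_succ_self, Finset.sum_sub_distrib, ← Finset.mul_sum,
      Finset.sum_range_succ _ (M + 1), Finset.sum_range_succ _ (M + 1),
      qFactInvSub_of_lt p M.lt_succ_self, ih, qFactInv_eq_succ hp M, qFactInv_eq_succ hp (M + s),
      ← Finset.sum_range_succ, show M + s + 1 = M + 1 + s by ring] at h
    refine mul_left_cancel₀ (mul_ne_zero (one_sub_pow_ne_zero hp (show M + 1 ≠ 0 by omega))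
      (one_sub_pow_ne_zero hp (show M + 1 + s ≠ 0 by omega))) ?_
    linear_combination h

theorem sum_pow_mul_qFactInvSub_mul_qFactInv {p : ℂ} (hp0 : p ≠ 0) (hp : ‖p‖ < 1) {r L : ℕ}
    (hr : r ≤ L) :
    ∑ n ∈ Finset.range (L + 1),
        p ^ n ^ 2 * (qFactInvSub p L n * (qFactInvSub p n r * qFactInv p (n + r))) =
      p ^ r ^ 2 * (qFactInvSub p L r * qFactInv p (L + r)) := by
  obtain ⟨M, rfl⟩ := Nat.exists_eq_add_of_le hr
  have hsmall : ∑ n ∈ Finset.range r,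
      p ^ n ^ 2 * (qFactInvSub p (r + M) n * (qFactInvSub p n r * qFactInv p (n + r))) = 0 :=
    Finset.sum_eq_zero fun n hn => by
      rw [qFactInvSub_of_lt p (Finset.mem_range.mp hn)]
      ring
  have hsub : ∀ m, qFactInvSub p (r + m) r = qFactInv p m := fun m => by
    simpa [qFactInvSub_zero_right] using qFactInvSub_add_add p m 0 r
  rw [add_assoc r M 1, Finset.sum_range_add, hsmall, zero_add, hsub,
    show r + M + r = M + 2 * r by ring, ← sum_pow_mul_qFactInv hp0 hp (2 * r) M, Finset.mul_sum]
  refine Finset.sum_congr rfl fun m _ => ?_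
  rw [qFactInvSub_add_add, hsub, show r + m + r = m + 2 * r by ring]
  ring

/-- Bailey's lemma with both parameters sent to infinity, before the limit in `L`. -/
theorem IsBaileyPair.sum_eq {p : ℂ} (hp0 : p ≠ 0) (hp : ‖p‖ < 1) {α β : ℕ → ℂ}
    (h : IsBaileyPair p α β) (L : ℕ) :
    ∑ n ∈ Finset.range (L + 1), p ^ n ^ 2 * β n * qFactInvSub p L n =
      ∑ r ∈ Finset.range (L + 1), p ^ r ^ 2 * α r * (qFactInvSub p L r * qFactInv p (L + r)) := by
  have hβ : ∀ n ∈ Finset.range (L + 1), p ^ n ^ 2 * β n * qFactInvSub p L n =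
      ∑ r ∈ Finset.range (L + 1), α r * (p ^ n ^ 2 *
        (qFactInvSub p L n * (qFactInvSub p n r * qFactInv p (n + r)))) := by
    intro n hn
    rw [← h n, Finset.sum_subset (Finset.range_subset_range.mpr (Finset.mem_range.mp hn)),
      Finset.mul_sum, Finset.sum_mul]
    · exact Finset.sum_congr rfl fun r _ => by ring
    · intro r _ hr
      rw [qFactInvSub_of_lt p (by simpa using hr)]
      ring
  rw [Finset.sum_congr rfl hβ, Finset.sum_comm]
  refine Finset.sum_congr rfl fun r hr => ?_
  rw [← Finset.mul_sum, sum_pow_mul_qFactInvSub_mul_qFactInv hp0 hp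
    (Nat.lt_succ_iff.mp (Finset.mem_range.mp hr))]
  ring

/-- The terms `(-1)^r p^{r(r-1)/2} (x^r + y^r)`, halved at `r = 0`. For `x y = p` these are the
terms of the theta series `∑ (-1)^r p^{r(r-1)/2} x^r` over the integers, with `r` and `-r` paired. -/
noncomputable def thetaTerm (p x y : ℂ) : ℕ → ℂ
  | 0 => 1
  | r + 1 => (-1) ^ (r + 1) * p ^ (r + 1).choose 2 * (x ^ (r + 1) + y ^ (r + 1))

theorem pow_choose_two_succ (p : ℂ) (k : ℕ) : p ^ (k + 1).choose 2 = p ^ k.choose 2 * p ^ k := by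
  rw [Nat.choose_succ_succ', Nat.choose_one_right, pow_add, mul_comm]

/-- Solving a first-order recurrence in `n` for a sum of Bailey type, given that the recurrence
holds up to a telescoping remainder. -/
theorem sum_eq_of_telescoping {p c d : ℂ} {n : ℕ} {α H : ℕ → ℂ}
    (hend : H (n + 1) = 0)
    (h0 : c * (α 0 * (qFactInvSub p (n + 1) 0 * qFactInv p (n + 1 + 0))) -
      d * (α 0 * (qFactInvSub p n 0 * qFactInv p (n + 0))) = H 0)
    (hstep : ∀ k, c * (α (k + 1) * (qFactInvSub p (n + 1) (k + 1) * qFactInv p (n + 1 + (k + 1)))) -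
      d * (α (k + 1) * (qFactInvSub p n (k + 1) * qFactInv p (n + (k + 1)))) = H (k + 1) - H k) :
    c * ∑ r ∈ Finset.range (n + 2), α r * (qFactInvSub p (n + 1) r * qFactInv p (n + 1 + r)) =
      d * ∑ r ∈ Finset.range (n + 1), α r * (qFactInvSub p n r * qFactInv p (n + r)) := by
  have key : ∀ k, ∑ r ∈ Finset.range (k + 1),
      (c * (α r * (qFactInvSub p (n + 1) r * qFactInv p (n + 1 + r))) -
        d * (α r * (qFactInvSub p n r * qFactInv p (n + r)))) = H k := by
    intro k
    induction k with
    | zero => rw [zero_add, Finset.sum_range_one, h0]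
    | succ k ih => rw [Finset.sum_range_succ, ih, hstep, add_sub_cancel]
  have h := key (n + 1)
  rw [Finset.sum_sub_distrib, ← Finset.mul_sum, ← Finset.mul_sum, hend, sub_eq_zero] at h
  rw [h, Finset.sum_range_succ _ (n + 1), qFactInvSub_of_lt p n.lt_succ_self]
  ring

/-- The finite form of the Jacobi triple product, as a Bailey pair. -/
theorem isBaileyPair_thetaTerm {x y : ℂ} (hxy0 : x * y ≠ 0) (hxy : ‖x * y‖ < 1) :
    IsBaileyPair (x * y) (thetaTerm (x * y) x y) fun n =>
      qPoch (x * y) x n * qPoch (x * y) y n * qFactInv (x * y) (2 * n) := by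
  obtain ⟨p, hp⟩ : ∃ p, p = x * y := ⟨_, rfl⟩
  rw [← hp] at hxy0 hxy ⊢
  intro n
  induction n with
  | zero => simp [thetaTerm, qFactInvSub_zero_right, qFactInv_zero, qPoch_zero]
  | succ n ih =>
    have hrec := sum_eq_of_telescoping (p := p) (n := n) (α := thetaTerm p x y)
      (c := (1 - p ^ (2 * n + 2)) * (1 - p ^ (2 * n + 1)))
      (d := (1 - x * p ^ n) * (1 - y * p ^ n))
      (H := fun k => (-1) ^ k * p ^ k.choose 2 * p ^ n *
        ((y * (1 - x * p ^ n) * p ^ k + (1 - y * p ^ n)) * x ^ (k + 1) +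
          (x * (1 - y * p ^ n) * p ^ k + (1 - x * p ^ n)) * y ^ (k + 1)) *
        (qFactInvSub p n k * qFactInv p (n + 1 + k)))
      (by simp [qFactInvSub_of_lt]) ?_ ?_
    · beta_reduce at ih ⊢
      rw [ih, show 2 * n + 2 = 2 * n + 1 + 1 by ring] at hrec
      rw [qFactInv_eq_succ hxy (2 * n), qFactInv_eq_succ hxy (2 * n + 1)] at hrec
      refine mul_left_cancel₀ (mul_ne_zero (one_sub_pow_ne_zero hxy (show 2 * n + 1 + 1 ≠ 0 by omega))
        (one_sub_pow_ne_zero hxy (show 2 * n + 1 ≠ 0 by omega))) (hrec.trans ?_)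
      rw [qPoch_succ, qPoch_succ, show 2 * (n + 1) = 2 * n + 1 + 1 by ring]
      ring
    · simp only [thetaTerm, qFactInvSub_zero_right, qFactInv_eq_succ hxy n, add_zero]
      have e1 : p ^ (2 * n + 2) = (p * p ^ n) ^ 2 := by ring
      have e2 : p ^ (2 * n + 1) = p * (p ^ n) ^ 2 := by ring
      rw [e1, e2, pow_succ' p n]
      generalize p ^ n = D
      generalize qFactInv p (n + 1) = u
      subst hp
      simp only [pow_zero, pow_one, zero_add, Nat.choose_zero_succ]
      ring
    · intro k
      have h := pow_mul_qFactInvSub hxy n (k + 1)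
      refine mul_left_cancel₀ (pow_ne_zero (k + 1) hxy0) ?_
      simp only [thetaTerm, ← qFactInvSub_succ_succ p n k, show n + (k + 1) = n + 1 + k by ring,
        pow_choose_two_succ, ← add_assoc (n + 1) k 1]
      rw [qFactInv_eq_succ hxy (n + 1 + k)]
      generalize qFactInvSub p (n + 1) (k + 1) = u at *
      generalize qFactInvSub p n (k + 1) = v at *
      generalize qFactInv p (n + 1 + k + 1) = w
      have e1 : p ^ (2 * n + 2) = (p * p ^ n) ^ 2 := by ring
      have e2 : p ^ (2 * n + 1) = p * (p ^ n) ^ 2 := by ring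
      have e3 : p ^ (n + 1 + k + 1) = p ^ 2 * p ^ n * p ^ k := by ring
      rw [e1, e2, e3]
      simp only [pow_succ' p n, pow_succ' p k, pow_succ _ (k + 1), pow_succ x k, pow_succ y k,
        pow_succ (-1 : ℂ) k] at h ⊢
      generalize p ^ n = D at *
      generalize p ^ k = z at *
      generalize p ^ k.choose 2 = a
      generalize x ^ k = X
      generalize y ^ k = Y
      generalize (-1 : ℂ) ^ k = σ
      subst hp
      linear_combination w * σ * a * z * ((1 - x * D) * (1 - y * D) * (X * x + Y * y) *
        (1 - (x * y) ^ 2 * D * z) + D * ((y * (1 - x * D) * (x * y * z) + (1 - y * D)) * (X * x * x) +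
          (x * (1 - y * D) * (x * y * z) + (1 - x * D)) * (Y * y * y))) * h

theorem isBaileyPair_sq_thetaTerm {q : ℂ} (hq0 : q ≠ 0) (hq : ‖q‖ < 1) :
    IsBaileyPair (q ^ 2) (thetaTerm q 1 q) fun n =>
      (-1) ^ n * q ^ n ^ 2 / (qPoch (q ^ 2) (-q) n * qPoch (q ^ 4) (q ^ 4) n) := by
  have hp : ‖q ^ 2‖ < 1 := norm_pow_lt_one hq two_ne_zero
  intro n
  induction n with
  | zero => simp [thetaTerm, qFactInvSub_zero_right, qFactInv_zero, qPoch_zero]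
  | succ n ih =>
    have hrec := sum_eq_of_telescoping (p := q ^ 2) (n := n) (α := thetaTerm q 1 q)
      (c := (1 + q ^ (2 * n + 1)) * (1 - q ^ (4 * n + 4))) (d := -q ^ (2 * n + 1))
      (H := fun k => (-1) ^ k * q ^ k.choose 2 *
        (q ^ (2 * n + 1) * q * (q ^ k) ^ 2 + (1 + q ^ (2 * n + 1)) * q ^ k + q ^ (2 * n + 1)) *
        (qFactInvSub (q ^ 2) n k * qFactInv (q ^ 2) (n + 1 + k)))
      (by simp [qFactInvSub_of_lt]) ?_ ?_
    · beta_reduce at ih ⊢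
      have h1 : 1 + q ^ (2 * n + 1) ≠ 0 := by
        have h := one_sub_mul_pow_ne_zero hp ((norm_neg q).trans_lt hq) n
        rwa [show 1 - -q * (q ^ 2) ^ n = 1 + q ^ (2 * n + 1) by ring] at h
      have h2 : 1 - q ^ (4 * n + 4) ≠ 0 := one_sub_pow_ne_zero hq (by omega)
      have h3 := qPoch_ne_zero hp ((norm_neg q).trans_lt hq) n
      have hq4 : ‖q ^ 4‖ < 1 := norm_pow_lt_one hq four_ne_zero
      have h4 := qPoch_ne_zero hq4 hq4 n
      rw [ih] at hrec
      refine mul_left_cancel₀ (mul_ne_zero h1 h2) (hrec.trans ?_)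
      rw [qPoch_succ, qPoch_succ, show 1 - -q * (q ^ 2) ^ n = 1 + q ^ (2 * n + 1) by ring,
        show 1 - q ^ 4 * (q ^ 4) ^ n = 1 - q ^ (4 * n + 4) by ring]
      field_simp
      ring
    · simp only [thetaTerm, qFactInvSub_zero_right, qFactInv_eq_succ hp n, add_zero]
      have e1 : q ^ (4 * n + 4) = (q * q ^ (2 * n + 1)) ^ 2 := by ring
      have e2 : (q ^ 2) ^ (n + 1) = q * q ^ (2 * n + 1) := by ring
      rw [e1, e2]
      generalize q ^ (2 * n + 1) = D
      generalize qFactInv (q ^ 2) (n + 1) = u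
      simp only [pow_zero, Nat.choose_zero_succ]
      ring
    · intro k
      have h := pow_mul_qFactInvSub hp n (k + 1)
      refine mul_left_cancel₀ (pow_ne_zero (k + 1) (pow_ne_zero 2 hq0)) ?_
      simp only [thetaTerm, ← qFactInvSub_succ_succ (q ^ 2) n k,
        show n + (k + 1) = n + 1 + k by ring, pow_choose_two_succ, ← add_assoc (n + 1) k 1]
      rw [qFactInv_eq_succ hp (n + 1 + k)]
      generalize qFactInvSub (q ^ 2) (n + 1) (k + 1) = u at *
      generalize qFactInvSub (q ^ 2) n (k + 1) = v at *
      generalize qFactInv (q ^ 2) (n + 1 + k + 1) = w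
      have e1 : q ^ (4 * n + 4) = (q * q ^ (2 * n + 1)) ^ 2 := by ring
      have e2 : (q ^ 2) ^ (n + 1) = q * q ^ (2 * n + 1) := by ring
      have e3 : (q ^ 2) ^ (n + 1 + k + 1) = q ^ (2 * n + 1) * q ^ 3 * (q ^ k) ^ 2 := by ring
      have e4 : (q ^ 2) ^ (k + 1) = q ^ 2 * (q ^ k) ^ 2 := by ring
      rw [e2, e4] at h
      rw [e1, e3, e4]
      simp only [pow_succ q k, pow_succ (-1 : ℂ) k, one_pow]
      generalize q ^ (2 * n + 1) = D at *
      generalize q ^ k = z at *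
      generalize q ^ k.choose 2 = a
      generalize (-1 : ℂ) ^ k = σ
      linear_combination w * σ * a * z * (-D * (1 + z * q) * (1 - D * q ^ 3 * z ^ 2) +
        (D * q * (z * q) ^ 2 + (1 + D) * (z * q) + D)) * h

open Filter Topology in
theorem tendsto_qPoch {p : ℂ} (hp : ‖p‖ < 1) (a : ℂ) :
    Tendsto (qPoch p a) atTop (𝓝 (qPochInf p a)) := by
  have hs : Summable fun j : ℕ => ‖-(a * p ^ j)‖ := by
    simpa using (summable_geometric_of_lt_one (norm_nonneg p) hp).mul_left ‖a‖
  simpa only [← sub_eq_add_neg] using! (multipliable_one_add_of_summable hs).tendsto_prod_tprod_nat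

theorem qPochInf_ne_zero {p a : ℂ} (hp : ‖p‖ < 1) (ha : ‖a‖ < 1) : qPochInf p a ≠ 0 := by
  have hs : Summable fun j : ℕ => ‖-(a * p ^ j)‖ := by
    simpa using (summable_geometric_of_lt_one (norm_nonneg p) hp).mul_left ‖a‖
  have := tprod_one_add_ne_zero_of_summable (f := fun j : ℕ => -(a * p ^ j))
    (fun j => by simpa only [← sub_eq_add_neg] using one_sub_mul_pow_ne_zero hp ha j) hs
  simpa only [← sub_eq_add_neg] using! this

open Filter Topology in
theorem tendsto_inv_qPoch {p a : ℂ} (hp : ‖p‖ < 1) (ha : ‖a‖ < 1) :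
    Tendsto (fun n => (qPoch p a n)⁻¹) atTop (𝓝 (qPochInf p a)⁻¹) :=
  (tendsto_qPoch hp a).inv₀ (qPochInf_ne_zero hp ha)

theorem exists_norm_inv_qPoch_le {p a : ℂ} (hp : ‖p‖ < 1) (ha : ‖a‖ < 1) :
    ∃ C, ∀ n, ‖(qPoch p a n)⁻¹‖ ≤ C := by
  obtain ⟨C, hC⟩ := (Metric.isBounded_range_of_tendsto _ (tendsto_inv_qPoch hp ha)).exists_norm_le
  exact ⟨C, fun n => hC _ ⟨n, rfl⟩⟩

theorem exists_norm_qFactInv_le {p : ℂ} (hp : ‖p‖ < 1) :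
    ∃ C, 0 ≤ C ∧ (∀ n, ‖qFactInv p n‖ ≤ C) ∧ ∀ n r, ‖qFactInvSub p n r‖ ≤ C := by
  obtain ⟨C, hC⟩ := exists_norm_inv_qPoch_le hp hp
  have hC0 : 0 ≤ C := (norm_nonneg _).trans (hC 0)
  refine ⟨C, hC0, hC, fun n r => ?_⟩
  rw [qFactInvSub]
  split_ifs
  · exact hC _
  · simpa using hC0

open Filter Topology in
theorem tendsto_qFactInvSub {p : ℂ} (hp : ‖p‖ < 1) (r : ℕ) :
    Tendsto (fun n => qFactInvSub p n r) atTop (𝓝 (qPochInf p p)⁻¹) := by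
  refine ((tendsto_inv_qPoch hp hp).comp (tendsto_sub_atTop_nat r)).congr' ?_
  filter_upwards [eventually_ge_atTop r] with n hn
  rw [qFactInvSub, if_pos hn]
  rfl

open Filter Topology in
/-- Tannery's theorem for sums whose `n`-th instance runs over `r ≤ n`. -/
theorem tendsto_sum_range_mul {a : ℕ → ℂ} (ha : Summable fun r => ‖a r‖) {F : ℕ → ℕ → ℂ}
    {C : ℝ} (hC : ∀ n r, ‖F n r‖ ≤ C) (hF : ∀ n r, n < r → F n r = 0) {l : ℂ}
    (hl : ∀ r, Tendsto (fun n => F n r) atTop (𝓝 l)) :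
    Tendsto (fun n => ∑ r ∈ Finset.range (n + 1), a r * F n r) atTop (𝓝 ((∑' r, a r) * l)) := by
  have h := tendsto_tsum_of_dominated_convergence (𝓕 := atTop) (f := fun n r => a r * F n r)
    (g := fun r => a r * l) (ha.mul_right C) (fun r => (hl r).const_mul (a r))
    (Eventually.of_forall fun n r => by
      rw [norm_mul]
      exact mul_le_mul_of_nonneg_left (hC n r) (norm_nonneg _))
  rw [tsum_mul_right] at h
  refine h.congr fun n => tsum_eq_sum fun r hr => ?_
  rw [hF n r (by simpa using hr), mul_zero]

open Filter Topology in
theorem tendsto_sum_mul_qFactInvSub_mul_qFactInv {p : ℂ} (hp : ‖p‖ < 1) {a : ℕ → ℂ}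
    (ha : Summable fun r => ‖a r‖) :
    Tendsto (fun n => ∑ r ∈ Finset.range (n + 1), a r * (qFactInvSub p n r * qFactInv p (n + r)))
      atTop (𝓝 ((∑' r, a r) * ((qPochInf p p)⁻¹ * (qPochInf p p)⁻¹))) := by
  obtain ⟨C, hC0, hC, hC'⟩ := exists_norm_qFactInv_le hp
  refine tendsto_sum_range_mul ha (C := C * C) (fun n r => ?_) (fun n r h => ?_) fun r => ?_
  · rw [norm_mul]
    exact mul_le_mul (hC' n r) (hC _) (norm_nonneg _) hC0
  · rw [qFactInvSub_of_lt p h, zero_mul]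
  · exact (tendsto_qFactInvSub hp r).mul
      ((tendsto_inv_qPoch hp hp).comp (tendsto_add_atTop_nat r))

/-- Bailey's lemma with both parameters sent to infinity. -/
theorem IsBaileyPair.tsum_eq {p : ℂ} (hp0 : p ≠ 0) (hp : ‖p‖ < 1) {α β : ℕ → ℂ}
    (h : IsBaileyPair p α β) (hα : Summable fun r => ‖p ^ r ^ 2 * α r‖)
    (hβ : Summable fun n => ‖p ^ n ^ 2 * β n‖) :
    ∑' n, p ^ n ^ 2 * β n = (∑' r, p ^ r ^ 2 * α r) / qPochInf p p := by
  obtain ⟨C, -, -, hC⟩ := exists_norm_qFactInv_le hp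
  have h1 := tendsto_sum_range_mul hβ hC (fun n r => qFactInvSub_of_lt p) (tendsto_qFactInvSub hp)
  have h2 := tendsto_sum_mul_qFactInvSub_mul_qFactInv hp hα
  simp only [← h.sum_eq hp0 hp] at h2
  have h3 := tendsto_nhds_unique h1 h2
  rw [← mul_assoc] at h3
  exact mul_right_cancel₀ (inv_ne_zero (qPochInf_ne_zero hp hp)) h3

theorem norm_thetaTerm_le {p x y : ℂ} (hp : ‖p‖ < 1) (r : ℕ) :
    ‖thetaTerm p x y r‖ ≤ ‖x‖ ^ r + ‖y‖ ^ r := by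
  cases r with
  | zero => norm_num [thetaTerm]
  | succ r =>
    rw [thetaTerm, norm_mul, norm_mul, norm_pow, norm_neg, norm_one, one_pow, one_mul, norm_pow,
      ← norm_pow x, ← norm_pow y]
    exact (mul_le_of_le_one_left (norm_nonneg _) (pow_le_one₀ (norm_nonneg _) hp.le)).trans
      (norm_add_le _ _)

theorem summable_norm_thetaTerm {p x y : ℂ} (hp : ‖p‖ < 1) (hx : ‖x‖ < 1) (hy : ‖y‖ < 1) :
    Summable fun r => ‖thetaTerm p x y r‖ :=
  Summable.of_nonneg_of_le (fun _ => norm_nonneg _) (norm_thetaTerm_le hp)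
    ((summable_geometric_of_lt_one (norm_nonneg x) hx).add
      (summable_geometric_of_lt_one (norm_nonneg y) hy))

/-- The Jacobi triple product identity. -/
theorem tsum_thetaTerm {x y : ℂ} (hx0 : x ≠ 0) (hy0 : y ≠ 0) (hx : ‖x‖ < 1) (hy : ‖y‖ < 1) :
    ∑' r, thetaTerm (x * y) x y r =
      qPochInf (x * y) x * qPochInf (x * y) y * qPochInf (x * y) (x * y) := by
  have hp : ‖x * y‖ < 1 := by simpa using norm_mul_pow_lt_one hy hx 1
  have h1 := tendsto_sum_mul_qFactInvSub_mul_qFactInv hp (summable_norm_thetaTerm hp hx hy)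
  have h2 := ((tendsto_qPoch hp x).mul (tendsto_qPoch hp y)).mul ((tendsto_inv_qPoch hp hp).comp
    (Filter.tendsto_id.const_mul_atTop' (zero_lt_two : (0 : ℕ) < 2)))
  have h3 := tendsto_nhds_unique
    (h1.congr (isBaileyPair_thetaTerm (mul_ne_zero hx0 hy0) hp)) h2
  have h4 := qPochInf_ne_zero hp hp
  field_simp at h3
  rw [h3]
  ring

theorem sq_eq_two_mul_choose_two_add (r : ℕ) : r ^ 2 = 2 * r.choose 2 + r := by
  induction r with
  | zero => rfl
  | succ r ih =>
    rw [Nat.choose_succ_succ', Nat.choose_one_right]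
    linarith

theorem pow_sq_mul_thetaTerm (q : ℂ) (r : ℕ) :
    (q ^ 2) ^ r ^ 2 * thetaTerm q 1 q r = thetaTerm (q ^ 2 * q ^ 3) (q ^ 2) (q ^ 3) r := by
  cases r with
  | zero => simp [thetaTerm]
  | succ r =>
    rw [thetaTerm, thetaTerm, sq_eq_two_mul_choose_two_add (r + 1)]
    ring

/-- Rogers' identity (Slater no. 19):
$\sum_{n\ge0} \frac{(-1)^nq^{3n^2}}{(-q;q^2)_n(q^4;q^4)_n}
 = \frac{(q^2,q^3,q^5;q^5)_\infty}{(q^2;q^2)_\infty}$. -/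
theorem slater_19 (q : ℂ) (hq : ‖q‖ < 1) :
    ∑' n : ℕ, (-1 : ℂ) ^ n * q ^ (3 * n ^ 2) /
        (qPoch (q ^ 2) (-q) n * qPoch (q ^ 4) (q ^ 4) n)
      = qPochInf (q ^ 5) (q ^ 2) * qPochInf (q ^ 5) (q ^ 3) * qPochInf (q ^ 5) (q ^ 5) /
          qPochInf (q ^ 2) (q ^ 2) := by
  rcases eq_or_ne q 0 with rfl | hq0
  · rw [tsum_eq_single 0 fun n hn => by simp [hn]]
    simp [qPoch_zero, qPochInf]
  have h2 : ‖q ^ 2‖ < 1 := norm_pow_lt_one hq two_ne_zero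
  have h3 : ‖q ^ 3‖ < 1 := norm_pow_lt_one hq three_ne_zero
  have h4 : ‖q ^ 4‖ < 1 := norm_pow_lt_one hq four_ne_zero
  have h5 : ‖q ^ 2 * q ^ 3‖ < 1 := by
    rw [← pow_add]
    exact norm_pow_lt_one hq (by norm_num)
  have hα : Summable fun r => ‖(q ^ 2) ^ r ^ 2 * thetaTerm q 1 q r‖ := by
    simpa only [pow_sq_mul_thetaTerm] using summable_norm_thetaTerm h5 h2 h3
  have hβ : Summable fun n : ℕ => ‖(q ^ 2) ^ n ^ 2 *
      ((-1) ^ n * q ^ n ^ 2 / (qPoch (q ^ 2) (-q) n * qPoch (q ^ 4) (q ^ 4) n))‖ := by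
    obtain ⟨A, hA⟩ := exists_norm_inv_qPoch_le h2 ((norm_neg q).trans_lt hq)
    obtain ⟨B, hB⟩ := exists_norm_inv_qPoch_le h4 h4
    refine Summable.of_nonneg_of_le (fun _ => norm_nonneg _) (fun n => ?_)
      ((summable_geometric_of_lt_one (norm_nonneg q) hq).mul_right (A * B))
    rw [show (q ^ 2) ^ n ^ 2 * ((-1) ^ n * q ^ n ^ 2 /
        (qPoch (q ^ 2) (-q) n * qPoch (q ^ 4) (q ^ 4) n)) = (-1) ^ n * q ^ (3 * n ^ 2) *
        ((qPoch (q ^ 2) (-q) n)⁻¹ * (qPoch (q ^ 4) (q ^ 4) n)⁻¹) by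
      rw [div_eq_mul_inv, mul_inv]; ring, norm_mul, norm_mul, norm_pow, norm_neg, norm_one,
      one_pow, one_mul, norm_pow, norm_mul]
    have hn : n ≤ 3 * n ^ 2 := by nlinarith
    exact mul_le_mul (pow_le_pow_of_le_one (norm_nonneg q) hq.le hn)
      (mul_le_mul (hA n) (hB n) (norm_nonneg _) ((norm_nonneg _).trans (hA n)))
      (by positivity) (by positivity)
  have h := (isBaileyPair_sq_thetaTerm hq0 hq).tsum_eq (pow_ne_zero 2 hq0) h2 hα hβ
  simp only [pow_sq_mul_thetaTerm] at h
  rw [tsum_thetaTerm (pow_ne_zero 2 hq0) (pow_ne_zero 3 hq0) h2 h3, ← pow_add] at h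
  rw [← h]
  refine tsum_congr fun n => ?_
  ring
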